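/- Let n ∈ {-1} ∪ ω and suppose κ ∉ I(Π^1_n(κ)). Then the set {α < κ : α is subtle and Π^1_{n+2}-indescribable} belongs to the filter I(Π^1_n(κ))* dual to I(Π^1_n(κ)). In particular, the least cardinal that is both subtle and Π^1_{n+2}-indescribable lies in I(Π^1_n(κ)) about itself, i.e., is not in I(Π^1_n)^+ at itself. -/

import Mathlib

namespace LCI


/-- `κ` is (the initial ordinal of) a regular uncountable cardinal. -/
def RegUncountable (kappa : Ordinal.{0}) : Prop :=
  Ordinal.omega0 < kappa ∧ kappa.cof.ord = kappa

/-- `C` is a club (closed unbounded) subset of the ordinal `κ`. -/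
def IsClubIn (C : Set Ordinal.{0}) (kappa : Ordinal.{0}) : Prop :=
  C ⊆ Set.Iio kappa ∧
  (∀ alpha < kappa, ∃ beta ∈ C, alpha < beta) ∧
  ∀ beta < kappa, beta ≠ 0 →
    (∀ gamma < beta, ∃ delta ∈ C, gamma < delta ∧ delta < beta) → beta ∈ C

/-- `S` is a stationary subset of the ordinal `κ`. -/
def IsStationaryIn (S : Set Ordinal.{0}) (kappa : Ordinal.{0}) : Prop :=
  S ⊆ Set.Iio kappa ∧ ∀ C, IsClubIn C kappa → (S ∩ C).Nonempty

/-- `H` is homogeneous for the list `L` (where `L α ⊆ α` on the relevant domain):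
whenever `α < β` are both in `H`, `L α = L β ∩ α`. -/
def Homog (L : Ordinal.{0} → Set Ordinal.{0}) (H : Set Ordinal.{0}) : Prop :=
  ∀ alpha ∈ H, ∀ beta ∈ H, alpha < beta → L alpha = L beta ∩ Set.Iio alpha

/-- `S ⊆ κ` is a subtle subset of `κ`: for every `S`-list `L` (i.e. `L α ⊆ α` for
`α ∈ S`) and every club `C ⊆ κ` there are `α < β` in `S ∩ C` with `L α = L β ∩ α`. -/
def IsSubtleIn (S : Set Ordinal.{0}) (kappa : Ordinal.{0}) : Prop :=
  S ⊆ Set.Iio kappa ∧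
  ∀ L : Ordinal.{0} → Set Ordinal.{0}, (∀ alpha ∈ S, L alpha ⊆ Set.Iio alpha) →
    ∀ C, IsClubIn C kappa →
      ∃ alpha ∈ S ∩ C, ∃ beta ∈ S ∩ C, alpha < beta ∧ L alpha = L beta ∩ Set.Iio alpha

/-- Second-order formulas over a structure `(M, ∈, A)` where `M` is a set of sets:
de Bruijn indexed first-order variables and second-order (subset) variables,
a binary membership relation, and a unary predicate for `A`. -/
inductive SOForm : Type where
  | mem : ℕ → ℕ → SOForm
  | app : ℕ → ℕ → SOForm
  | inA : ℕ → SOForm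
  | not : SOForm → SOForm
  | and : SOForm → SOForm → SOForm
  | fall : SOForm → SOForm
  | sall : SOForm → SOForm

/-- Prepend a value to a valuation (de Bruijn style). -/
def consVal {alpha : Type 1} (x : alpha) (v : ℕ → alpha) : ℕ → alpha
  | 0 => x
  | n + 1 => v n

/-- Satisfaction of a second-order formula in the structure `(M, ∈, A)`,
relative to first- and second-order valuations; first-order quantifiers range
over `M` and second-order quantifiers range over subsets of `M`. -/
def SOSat (M A : Set ZFSet.{0}) : SOForm → (ℕ → ZFSet.{0}) → (ℕ → Set ZFSet.{0}) → Prop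
  | .mem i j, v, _ => v i ∈ v j
  | .app i j, v, w => v j ∈ w i
  | .inA i, v, _ => v i ∈ A
  | .not phi, v, w => ¬ SOSat M A phi v w
  | .and phi psi, v, w => SOSat M A phi v w ∧ SOSat M A psi v w
  | .fall phi, v, w => ∀ x ∈ M, SOSat M A phi (consVal x v) w
  | .sall phi, v, w => ∀ P : Set ZFSet.{0}, P ⊆ M → SOSat M A phi v (consVal P w)

/-- A formula is first-order if it contains no second-order quantifier. -/
def SOForm.FO : SOForm → Prop
  | .not phi => phi.FO
  | .and phi psi => phi.FO ∧ psi.FO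
  | .fall phi => phi.FO
  | .sall _ => False
  | _ => True

mutual
  /-- `IsPiForm n φ` : `φ` is a `Π¹ₙ` formula. -/
  inductive IsPiForm : ℕ → SOForm → Prop where
    | fo {phi : SOForm} : phi.FO → IsPiForm 0 phi
    | up {n : ℕ} {phi : SOForm} : IsSigmaForm n phi → IsPiForm (n + 1) phi
    | all {n : ℕ} {phi : SOForm} : IsPiForm (n + 1) phi → IsPiForm (n + 1) (SOForm.sall phi)
  /-- `IsSigmaForm n φ` : `φ` is a `Σ¹ₙ` formula. -/
  inductive IsSigmaForm : ℕ → SOForm → Prop where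
    | fo {phi : SOForm} : phi.FO → IsSigmaForm 0 phi
    | up {n : ℕ} {phi : SOForm} : IsPiForm n phi → IsSigmaForm (n + 1) phi
    | ex {n : ℕ} {phi : SOForm} : IsSigmaForm (n + 1) phi →
        IsSigmaForm (n + 1) (SOForm.not (SOForm.sall (SOForm.not phi)))
end

/-- Satisfaction of a sentence: satisfaction under the default valuations. -/
def SOSatS (M A : Set ZFSet.{0}) (phi : SOForm) : Prop :=
  SOSat M A phi (fun _ => ∅) (fun _ => ∅)

/-- The rank-initial segment `V_α` of the set-theoretic universe. -/
def Vrank (alpha : Ordinal.{0}) : Set ZFSet.{0} := {x | ZFSet.rank x < alpha}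

/-- `X ⊆ κ` is a `Π¹ₙ`-indescribable subset of `κ` : for every `A ⊆ V_κ` and every
`Π¹ₙ` sentence `φ`, if `(V_κ, ∈, A) ⊨ φ` then `(V_ξ, ∈, A ∩ V_ξ) ⊨ φ` for some `ξ ∈ X`. -/
def PiIndesc (n : ℕ) (X : Set Ordinal.{0}) (kappa : Ordinal.{0}) : Prop :=
  X ⊆ Set.Iio kappa ∧
  ∀ A : Set ZFSet.{0}, A ⊆ Vrank kappa → ∀ phi : SOForm, IsPiForm n phi →
    SOSatS (Vrank kappa) A phi → ∃ xi ∈ X, SOSatS (Vrank xi) (A ∩ Vrank xi) phi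

/-- `X` is a `Π¹ₙ`-indescribable subset of `κ` for `n ∈ {-1} ∪ ω` : for `n ≥ 0` this is
`Π¹ₙ`-indescribability, and by convention for `n = -1` it means `X ⊆ κ` has cardinality `κ`
(i.e. `X ∈ ([κ]^{<κ})⁺`). -/
def PiPos (n : ℤ) (X : Set Ordinal.{0}) (kappa : Ordinal.{0}) : Prop :=
  match n with
  | Int.ofNat m => PiIndesc m X kappa
  | Int.negSucc _ => X ⊆ Set.Iio kappa ∧ Cardinal.mk ↥X = Cardinal.lift.{1} kappa.card

/-- The ideal `Π¹ₙ(κ)` of non-`Π¹ₙ`-indescribable subsets of `κ`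
(with the convention `Π¹₋₁(κ) = [κ]^{<κ}`). -/
def PiIdealZ (n : ℤ) (kappa : Ordinal.{0}) : Set (Set Ordinal.{0}) :=
  {X | X ⊆ Set.Iio kappa ∧ ¬ PiPos n X kappa}

/-- `S ∈ 𝓘(I)⁺` for the ideal with positive sets `P` : every `S`-list has a
homogeneous subset `H ⊆ S` satisfying `P`. -/
def IneffPos (kappa : Ordinal.{0}) (P : Set Ordinal.{0} → Prop) (S : Set Ordinal.{0}) : Prop :=
  S ⊆ Set.Iio kappa ∧
  ∀ L : Ordinal.{0} → Set Ordinal.{0}, (∀ alpha ∈ S, L alpha ⊆ Set.Iio alpha) →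
    ∃ H, H ⊆ S ∧ P H ∧ Homog L H

/-- The ideal `𝓘(Π¹ₙ(κ))` on `κ` (for `n ∈ {-1} ∪ ω`). -/
def IneffIdeal (n : ℤ) (kappa : Ordinal.{0}) : Set (Set Ordinal.{0}) :=
  {X | X ⊆ Set.Iio kappa ∧ ¬ IneffPos kappa (fun H => PiPos n H kappa) X}

open Cardinal in
/-- The map `r` has fewer than `κ` values below each ordinal `γ < κ`. -/
def SmallRank {U : Type 1} (kappa : Ordinal.{0}) (r : U → Ordinal.{0}) : Prop :=
  ∀ gamma < kappa, #{u | r u < gamma} < lift.{1} kappa.card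

/-- `H` is unbounded in `κ`. -/
def Unbdd (H : Set Ordinal.{0}) (kappa : Ordinal.{0}) : Prop :=
  ∀ gamma < kappa, ∃ beta ∈ H, gamma < beta

section Regular

open Cardinal

variable {kappa : Ordinal.{0}}

theorem RegUncountable.cof_eq (h : RegUncountable kappa) : kappa.cof = kappa.card := by
  conv_rhs => rw [← h.2, card_ord]

theorem RegUncountable.ord_card (h : RegUncountable kappa) : kappa.card.ord = kappa := by
  rw [← h.cof_eq, h.2]

theorem RegUncountable.aleph0_lt (h : RegUncountable kappa) : ℵ₀ < kappa.card := by
  rw [← ord_lt_ord, h.ord_card, ord_aleph0]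
  exact h.1

theorem RegUncountable.aleph0_lt_lift (h : RegUncountable kappa) :
    ℵ₀ < lift.{1} kappa.card := by
  rw [← lift_aleph0.{1, 0}, lift_lt]
  exact h.aleph0_lt

theorem RegUncountable.isRegular (h : RegUncountable kappa) : kappa.card.IsRegular :=
  ⟨h.aleph0_lt.le, by rw [h.ord_card, h.cof_eq]⟩

theorem RegUncountable.isSuccLimit (h : RegUncountable kappa) : Order.IsSuccLimit kappa := by
  rw [← h.ord_card]
  exact isSuccLimit_ord h.aleph0_lt.le

theorem RegUncountable.card_lt (h : RegUncountable kappa) {gamma : Ordinal.{0}}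
    (hg : gamma < kappa) : gamma.card < kappa.card := by
  rw [← h.ord_card] at hg
  exact lt_ord.1 hg

theorem RegUncountable.exists_bound (h : RegUncountable kappa) {s : Set Ordinal.{0}}
    (hs : #s < lift.{1} kappa.card) (hlt : ∀ i ∈ s, i < kappa) :
    ∃ b < kappa, ∀ i ∈ s, i < b := by
  refine ⟨sSup ((· + 1) '' s), Ordinal.sSup_add_one_lt_of_lt_cof ?_ hlt, fun i hi => ?_⟩
  · rwa [← Ordinal.lift_cof, h.cof_eq]
  · have hb : BddAbove ((· + 1) '' s) := by
      refine ⟨kappa, ?_⟩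
      rintro _ ⟨j, hj, rfl⟩
      exact Order.add_one_le_of_lt (hlt j hj)
    exact (Order.lt_add_one_iff.2 le_rfl).trans_le (le_csSup hb ⟨i, hi, rfl⟩)

theorem SmallRank.card_le (h : RegUncountable kappa) {U : Type 1} {r : U → Ordinal.{0}}
    (hr : SmallRank kappa r) : #{u | r u < kappa} ≤ lift.{1} kappa.card := by
  have hsub : {u | r u < kappa} ⊆ ⋃ g : Set.Iio kappa, {u | r u < g.1} := by
    intro u hu
    refine Set.mem_iUnion.2 ⟨⟨r u + 1, h.isSuccLimit.add_one_lt hu⟩, ?_⟩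
    exact (Order.lt_add_one_iff.2 le_rfl : r u < r u + 1)
  refine (mk_le_mk_of_subset hsub).trans ((mk_iUnion_le_sum_mk).trans ?_)
  refine (sum_le_sum _ (fun _ : Set.Iio kappa => lift.{1} kappa.card) fun g => (hr g.1 g.2).le).trans ?_
  rw [sum_const', mk_Iio_ordinal]
  exact (mul_eq_self h.aleph0_lt_lift.le).le

theorem SmallRank.exists_code (h : RegUncountable kappa) {U : Type 1} {r : U → Ordinal.{0}}
    (hr : SmallRank kappa r) : ∃ f : U → Ordinal.{0}, (∀ u, f u ≠ 0) ∧
      (∀ u, r u < kappa → f u < kappa) ∧ Set.InjOn f {u | r u < kappa} := by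
  have hc := hr.card_le h
  rw [← mk_Iio_ordinal] at hc
  obtain ⟨e⟩ := hc
  classical
  refine ⟨fun u => if hu : r u < kappa then (e ⟨u, hu⟩).1 + 1 else 1, fun u => ?_, fun u hu => ?_,
    fun u hu v hv huv => ?_⟩
  · dsimp only
    split_ifs <;> simp
  · simpa [hu] using h.isSuccLimit.add_one_lt (e ⟨u, hu⟩).2
  · rw [Set.mem_ofPred_eq] at hu hv
    simp only [hu, hv, dif_pos] at huv
    have := e.injective (Subtype.ext (Order.succ_injective (by simpa using huv)))
    exact congrArg Subtype.val this

theorem SmallRank.sumElim (h : RegUncountable kappa) {U V : Type 1} {r : U → Ordinal.{0}}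
    {s : V → Ordinal.{0}} (hr : SmallRank kappa r) (hs : SmallRank kappa s) :
    SmallRank kappa (Sum.elim r s) := by
  intro gamma hg
  have hsub : {u | Sum.elim r s u < gamma} ⊆
      Sum.inl '' {u | r u < gamma} ∪ Sum.inr '' {u | s u < gamma} := by
    rintro (u | u) hu
    · exact Or.inl ⟨u, hu, rfl⟩
    · exact Or.inr ⟨u, hu, rfl⟩
  refine (mk_le_mk_of_subset hsub).trans_lt ((mk_union_le _ _).trans_lt ?_)
  exact add_lt_of_lt h.aleph0_lt_lift.le (mk_image_le.trans_lt (hr gamma hg))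
    (mk_image_le.trans_lt (hs gamma hg))

theorem smallRank_id (h : RegUncountable kappa) : SmallRank kappa (id : Ordinal.{0} → _) := by
  intro gamma hg
  change #(Set.Iio gamma) < _
  rw [mk_Iio_ordinal, lift_lt]
  exact h.card_lt hg

theorem smallRank_max (h : RegUncountable kappa) :
    SmallRank kappa (fun p : Ordinal.{0} × Ordinal.{0} => max p.1 p.2) := by
  intro gamma hg
  have hsub : {p : Ordinal.{0} × Ordinal.{0} | max p.1 p.2 < gamma} ⊆
      Set.Iio gamma ×ˢ Set.Iio gamma := by
    intro p hp
    have hp' : max p.1 p.2 < gamma := hp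
    exact max_lt_iff.1 hp'
  refine (mk_le_mk_of_subset hsub).trans_lt ?_
  rw [mk_congr (Equiv.Set.prod _ _), mk_prod]
  simp only [lift_id, mk_Iio_ordinal]
  have := lift_lt.{0, 1}.2 (h.card_lt hg)
  exact mul_lt_of_lt h.aleph0_lt_lift.le this this

theorem smallRank_zero_of_countable (h : RegUncountable kappa) {U : Type 1} [Countable U] :
    SmallRank kappa (fun _ : U => 0) := by
  intro gamma _
  exact (mk_set_le _).trans_lt ((mk_le_aleph0 (α := U)).trans_lt h.aleph0_lt_lift)

theorem smallRank_rank (h : RegUncountable kappa)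
    (hlim : ∀ c < kappa.card, 2 ^ c < kappa.card) : SmallRank kappa ZFSet.rank.{0} := by
  have hin : kappa.card.IsInaccessible :=
    ⟨h.aleph0_lt, h.isRegular.2, fun {c} hc => hlim c hc⟩
  intro gamma hg
  have hset : {x : ZFSet.{0} | x.rank < gamma} = {x | x ∈ ZFSet.vonNeumann gamma} := by
    ext x
    exact ZFSet.mem_vonNeumann.symm
  have : #{x : ZFSet.{0} | x.rank < gamma} = lift.{1} (ZFSet.vonNeumann gamma).card := by
    rw [hset, ← ZFSet.cardinalMk_coe_sort]
    rfl
  rw [this, lift_lt, ZFSet.card_vonNeumann]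
  calc preBeth gamma < preBeth kappa.card.ord := preBeth_strictMono (by rwa [h.ord_card])
    _ = kappa.card := hin.preBeth_ord

end Regular

/-- An injective code for formulas. -/
def SOForm.code : SOForm → ℕ
  | .mem i j => Nat.pair 0 (Nat.pair i j)
  | .app i j => Nat.pair 1 (Nat.pair i j)
  | .inA i => Nat.pair 2 i
  | .not phi => Nat.pair 3 phi.code
  | .and phi psi => Nat.pair 4 (Nat.pair phi.code psi.code)
  | .fall phi => Nat.pair 5 phi.code
  | .sall phi => Nat.pair 6 phi.code

theorem SOForm.code_injective : Function.Injective SOForm.code := by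
  intro phi
  induction phi with
  | mem i j => intro psi h; cases psi <;> simp_all [SOForm.code]
  | app i j => intro psi h; cases psi <;> simp_all [SOForm.code]
  | inA i => intro psi h; cases psi <;> simp_all [SOForm.code]
  | not phi ih => intro psi h; cases psi <;> simp [SOForm.code] at h ⊢; exact ih h
  | and phi psi ih1 ih2 =>
    intro psi h
    cases psi <;> simp [SOForm.code] at h ⊢
    exact ⟨ih1 h.1, ih2 h.2⟩
  | fall phi ih => intro psi h; cases psi <;> simp [SOForm.code] at h ⊢; exact ih h
  | sall phi ih => intro psi h; cases psi <;> simp [SOForm.code] at h ⊢; exact ih h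

instance : Countable SOForm :=
  SOForm.code_injective.countable

section Lists

variable {kappa : Ordinal.{0}} {X : Set Ordinal.{0}}

open Cardinal in
theorem two_power_lt_of_ineffPos (h : RegUncountable kappa)
    (hX : IneffPos kappa (Unbdd · kappa) X) : ∀ c < kappa.card, 2 ^ c < kappa.card := by
  intro c hc
  by_contra! hle
  have hlam : c.ord < kappa := by
    rw [← h.ord_card]
    exact ord_lt_ord.2 hc
  have hmk : #(Set.Iio kappa) ≤ #(Set (Set.Iio c.ord)) := by
    rw [mk_set, mk_Iio_ordinal, mk_Iio_ordinal, card_ord, ← lift_two_power, lift_le]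
    exact hle
  obtain ⟨e⟩ := hmk
  classical
  let L : Ordinal.{0} → Set Ordinal.{0} := fun alpha =>
    (if ha : alpha < kappa then Subtype.val '' e ⟨alpha, ha⟩ else ∅) ∩ Set.Iio alpha
  obtain ⟨H, hHX, hH, hom⟩ := hX.2 L fun alpha _ => Set.inter_subset_right
  obtain ⟨alpha, haH, hla⟩ := hH _ hlam
  have ha := hX.1 (hHX haH)
  obtain ⟨beta, hbH, hab⟩ := hH _ ha
  have hb := hX.1 (hHX hbH)
  have key : ∀ gamma (hg : gamma < kappa), c.ord < gamma →
      L gamma = Subtype.val '' e ⟨gamma, hg⟩ := by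
    intro gamma hg hlg
    simp only [L, hg, dif_pos]
    refine Set.inter_eq_left.2 ?_
    rintro _ ⟨⟨x, hx⟩, -, rfl⟩
    exact lt_trans hx hlg
  have heq := hom alpha haH beta hbH hab
  rw [key alpha ha hla, key beta hb (hla.trans hab), Set.inter_eq_left.2] at heq
  · have := congrArg Subtype.val (e.injective (Subtype.val_injective.image_injective heq))
    exact hab.ne this
  · rintro _ ⟨⟨x, hx⟩, -, rfl⟩
    exact lt_trans hx hla

/-- The points of a club `D` which are closed under `g` on an unbounded set of arguments are unbounded in `κ`. -/
theorem exists_closure_point (h : RegUncountable kappa) {D : Set Ordinal.{0}}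
    (hD : IsClubIn D kappa) {g : Ordinal.{0} → Ordinal.{0}} (hg : ∀ a < kappa, g a < kappa)
    {gamma : Ordinal.{0}} (hgamma : gamma < kappa) :
    ∃ e ∈ D, gamma < e ∧ ∀ a < e, ∃ b, a ≤ b ∧ b < e ∧ g b < e := by
  choose! d hdD hd using hD.2.1
  let k : Ordinal.{0} → Ordinal.{0} := fun a => d (max a (g a)) + 1
  have hmax : ∀ a < kappa, max a (g a) < kappa := fun a ha => max_lt ha (hg a ha)
  have hk : ∀ a < kappa, k a < kappa := fun a ha =>
    h.isSuccLimit.add_one_lt (hD.1 (hdD _ (hmax a ha)))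
  have hdk : ∀ a, d (max a (g a)) < k a := fun a => Order.lt_add_one_iff.2 le_rfl
  have hlt : ∀ a < kappa, a < k a := fun a ha =>
    ((le_max_left a (g a)).trans_lt (hd _ (hmax a ha))).trans (hdk a)
  have hgk : ∀ a < kappa, g a < k a := fun a ha =>
    ((le_max_right a (g a)).trans_lt (hd _ (hmax a ha))).trans (hdk a)
  have hek : Ordinal.nfp k gamma < kappa :=
    Ordinal.nfp_lt_ord (by rw [h.cof_eq]; exact h.aleph0_lt) hk hgamma
  have hit : ∀ n, k^[n] gamma < kappa := fun n => (Ordinal.iterate_le_nfp k gamma n).trans_lt hek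
  have hstep : ∀ n, k (k^[n] gamma) ≤ Ordinal.nfp k gamma := fun n => by
    have := Ordinal.iterate_le_nfp k gamma (n + 1)
    rwa [Function.iterate_succ_apply'] at this
  have hge : gamma < Ordinal.nfp k gamma := (hlt _ hgamma).trans_le (hstep 0)
  refine ⟨_, hD.2.2 _ hek (pos_of_gt hge).ne' ?_, hge, ?_⟩
  · intro a ha
    obtain ⟨n, hn⟩ := Ordinal.lt_nfp_iff.1 ha
    refine ⟨_, hdD _ (hmax _ (hit n)), ?_, (hdk _).trans_le (hstep n)⟩
    exact (hn.trans_le (le_max_left _ _)).trans (hd _ (hmax _ (hit n)))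
  · intro a ha
    obtain ⟨n, hn⟩ := Ordinal.lt_nfp_iff.1 ha
    exact ⟨_, hn.le, (hlt _ (hit n)).trans_le (hstep n), (hgk _ (hit n)).trans_le (hstep n)⟩

theorem isClubIn_closure_points (h : RegUncountable kappa) {D : Set Ordinal.{0}}
    (hD : IsClubIn D kappa) {U : Type 1} {r f : U → Ordinal.{0}} (hr : SmallRank kappa r)
    (hf : ∀ u, r u < kappa → f u < kappa) :
    IsClubIn {a | a ∈ D ∧ ∀ u, r u < a → f u < a} kappa := by
  refine ⟨fun a ha => hD.1 ha.1, ?_, ?_⟩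
  · have hb : ∀ a < kappa, ∃ b < kappa, ∀ u, r u < a → f u < b := by
      intro a ha
      obtain ⟨b, hb, hb'⟩ := h.exists_bound (s := f '' {u | r u < a})
        (Cardinal.mk_image_le.trans_lt (hr a ha)) (by
          rintro _ ⟨u, hu, rfl⟩
          exact hf u (lt_trans hu ha))
      exact ⟨b, hb, fun u hu => hb' _ ⟨u, hu, rfl⟩⟩
    choose! g hg hg' using hb
    intro gamma hgamma
    obtain ⟨e, heD, hge, he⟩ := exists_closure_point h hD
      (g := fun a => g (a + 1)) (fun a ha => hg _ (h.isSuccLimit.add_one_lt ha)) hgamma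
    refine ⟨e, ⟨heD, fun u hu => ?_⟩, hge⟩
    obtain ⟨b, hub, hbe, hgb⟩ := he _ hu
    exact (hg' _ (h.isSuccLimit.add_one_lt (hbe.trans (hD.1 heD))) u
      (Order.lt_add_one_iff.2 hub)).trans hgb
  · intro b hb hb0 hlim
    refine ⟨hD.2.2 b hb hb0 fun c hc => ?_, fun u hu => ?_⟩
    · obtain ⟨d, hd, hcd, hdb⟩ := hlim c hc
      exact ⟨d, hd.1, hcd, hdb⟩
    · obtain ⟨d, hd, hcd, hdb⟩ := hlim _ hu
      exact (hd.2 u hcd).trans hdb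

/-- Every list of subsets of a structure with a small rank function has an unbounded homogeneous
set inside a given club. -/
theorem exists_unbdd_homog (h : RegUncountable kappa)
    (hX : IneffPos kappa (Unbdd · kappa) X) {D : Set Ordinal.{0}} (hD : IsClubIn D kappa)
    {U : Type 1} {r : U → Ordinal.{0}} (hr : SmallRank kappa r) (A : Ordinal.{0} → Set U) :
    ∃ H, H ⊆ X ∩ D ∧ Unbdd H kappa ∧
      ∀ alpha ∈ H, ∀ beta ∈ H, alpha < beta → ∀ u, r u < alpha → (u ∈ A alpha ↔ u ∈ A beta) := by
  obtain ⟨f, hf0, hfk, hinj⟩ := hr.exists_code h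
  set E := {a | a ∈ D ∧ ∀ u, r u < a → f u < a}
  have hE : IsClubIn E kappa := isClubIn_closure_points h hD hr hfk
  have hgap : ∀ a, a < kappa ∧ a ≠ 0 ∧ a ∉ E → ∃ c < a, ∀ e ∈ E, e < a → e ≤ c := by
    rintro a ⟨ha, ha0, haE⟩
    by_contra! hcon
    exact haE (hE.2.2 a ha ha0 fun c hc => by
      obtain ⟨e, he, hea, hce⟩ := hcon c hc
      exact ⟨e, he, hce, hea⟩)
  choose! c hca hcE using hgap
  classical
  let L : Ordinal.{0} → Set Ordinal.{0} := fun a =>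
    if a ∈ E then f '' {u | u ∈ A a ∧ r u < a} else if a = 0 then ∅ else {0, c a}
  have hLE : ∀ a ∈ E, L a = f '' {u | u ∈ A a ∧ r u < a} := fun a ha => if_pos ha
  have hLN : ∀ a, a ∉ E → a ≠ 0 → L a = {0, c a} := fun a ha ha0 => by
    simp only [L, if_neg ha, if_neg ha0]
  have hL : ∀ a ∈ X, L a ⊆ Set.Iio a := by
    intro a haX
    by_cases haE : a ∈ E
    · rw [hLE a haE]
      rintro _ ⟨u, hu, rfl⟩
      exact haE.2 u hu.2
    · by_cases ha0 : a = 0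
      · simp [L, ha0]
      · rw [hLN a haE ha0]
        rintro _ (rfl | rfl)
        · exact pos_iff_ne_zero.2 ha0
        · exact hca a ⟨hX.1 haX, ha0, haE⟩
  obtain ⟨H, hHX, hH, hom⟩ := hX.2 L hL
  have hHk : ∀ a ∈ H, a < kappa := fun a ha => hX.1 (hHX ha)
  have hHE : ∀ a ∈ H, a ≠ 0 → a ∈ E := by
    intro a haH ha0
    by_contra haE
    have hout : ∀ b ∈ H, a < b → b ∉ E := by
      intro b hbH hab hbE
      have h0 : (0 : Ordinal) ∈ L a := by simp [hLN a haE ha0]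
      rw [hom a haH b hbH hab, hLE b hbE] at h0
      obtain ⟨u, -, hu⟩ := h0.1
      exact hf0 u hu
    obtain ⟨e, heE, hae⟩ := hE.2.1 a (hHk a haH)
    obtain ⟨b, hbH, heb⟩ := hH e (hE.1 heE)
    obtain ⟨e', heE', hbe⟩ := hE.2.1 b (hHk b hbH)
    obtain ⟨b', hbH', heb'⟩ := hH e' (hE.1 heE')
    have hb0 : b ≠ 0 := (pos_of_gt heb).ne'
    have hb0' : b' ≠ 0 := (pos_of_gt heb').ne'
    have hbE := hout b hbH (hae.trans heb)
    have hbE' := hout b' hbH' ((hae.trans heb).trans (hbe.trans heb'))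
    have hcb := hcE b ⟨hHk b hbH, hb0, hbE⟩ e heE heb
    have hcb' := hcE b' ⟨hHk b' hbH', hb0', hbE'⟩ e' heE' heb'
    have hmem : c b ∈ L b := by simp [hLN b hbE hb0]
    rw [hom b hbH b' hbH' (hbe.trans heb'), hLN b' hbE' hb0'] at hmem
    obtain ⟨h1 | h1, h2⟩ := hmem
    · rw [h1] at hcb
      exact (pos_of_gt hae).not_ge hcb
    · rw [Set.mem_singleton_iff.1 h1] at h2
      exact (hbe.trans_le hcb').not_gt h2
  refine ⟨H \ {0}, fun a ha => ⟨hHX ha.1, (hHE a ha.1 ha.2).1⟩, fun g hg => ?_, ?_⟩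
  · obtain ⟨b, hb, hgb⟩ := hH g hg
    exact ⟨b, ⟨hb, (pos_of_gt hgb).ne'⟩, hgb⟩
  · intro a ha b hb hab u hu
    have haE := hHE a ha.1 ha.2
    have hmem : ∀ d ∈ E, d < kappa → r u < d → (u ∈ A d ↔ f u ∈ L d) := by
      intro d hd hdk hud
      rw [hLE d hd]
      refine ⟨fun hA => ⟨u, ⟨hA, hud⟩, rfl⟩, ?_⟩
      rintro ⟨v, ⟨hv, hvd⟩, hvu⟩
      rwa [← hinj (lt_trans hvd hdk : r v < kappa) (lt_trans hud hdk : r u < kappa) hvu]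
    rw [hmem a haE (hHk a ha.1) hu, hmem b (hHE b hb.1 hb.2) (hHk b hb.1) (hu.trans hab),
      hom a ha.1 b hb.1 hab]
    exact and_iff_left (haE.2 u hu)

theorem isClubIn_Iio (h : RegUncountable kappa) : IsClubIn (Set.Iio kappa) kappa :=
  ⟨subset_rfl, fun a ha => ⟨a + 1, h.isSuccLimit.add_one_lt ha, Order.lt_add_one_iff.2 le_rfl⟩,
    fun _ hb _ _ => hb⟩

/-- An almost ineffable set contains, for each `m`, a subtle `Π¹ₘ`-indescribable ordinal. -/
theorem exists_subtle_indesc (h : RegUncountable kappa)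
    (hX : IneffPos kappa (Unbdd · kappa) X) (m : ℕ) :
    ∃ alpha ∈ X, IsSubtleIn (Set.Iio alpha) alpha ∧ PiIndesc m (Set.Iio alpha) alpha := by
  by_contra! hcon
  have hdata : ∀ alpha, ∃ (L : Ordinal.{0} → Set Ordinal.{0}) (C : Set Ordinal.{0})
      (A : Set ZFSet.{0}) (phi : SOForm), alpha ∈ X →
      ((∀ xi < alpha, L xi ⊆ Set.Iio xi) ∧ IsClubIn C alpha ∧
        ∀ xi ∈ C, ∀ eta ∈ C, xi < eta → L xi ≠ L eta ∩ Set.Iio xi) ∨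
      (A ⊆ Vrank alpha ∧ SOSatS (Vrank alpha) A phi ∧
        ∀ xi < alpha, ¬ SOSatS (Vrank xi) (A ∩ Vrank xi) phi) := by
    intro alpha
    by_cases haX : alpha ∈ X
    · by_cases hs : IsSubtleIn (Set.Iio alpha) alpha
      · have hp := hcon alpha haX hs
        simp only [PiIndesc, subset_rfl, true_and] at hp
        push Not at hp
        obtain ⟨A, hA, phi, -, hphi, hno⟩ := hp
        exact ⟨fun _ => ∅, ∅, A, phi, fun _ => Or.inr ⟨hA, hphi, hno⟩⟩
      · simp only [IsSubtleIn, subset_rfl, true_and] at hs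
        push Not at hs
        obtain ⟨L, hL, C, hC, hno⟩ := hs
        exact ⟨L, C, ∅, .inA 0, fun _ => Or.inl ⟨hL, hC, fun xi hx eta he =>
          hno xi ⟨hC.1 hx, hx⟩ eta ⟨hC.1 he, he⟩⟩⟩
    · exact ⟨fun _ => ∅, ∅, ∅, .inA 0, fun hX => absurd hX haX⟩
  choose L C A phi hdata using hdata
  have hr := ((smallRank_max h).sumElim h (smallRank_id h)).sumElim h
    ((smallRank_rank h (two_power_lt_of_ineffPos h hX)).sumElim h
      (smallRank_zero_of_countable h (U := ULift.{1} SOForm)))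
  obtain ⟨H, hHX, hH, hom⟩ := exists_unbdd_homog h hX (isClubIn_Iio h) hr fun alpha =>
    {u | Sum.elim (Sum.elim (fun p => p.2 ∈ L alpha p.1) (· ∈ C alpha))
      (Sum.elim (· ∈ A alpha) (fun psi => psi.down = phi alpha)) u}
  have hHk : ∀ a ∈ H, a < kappa := fun a ha => (hHX ha).2
  have homL : ∀ a ∈ H, ∀ b ∈ H, a < b → ∀ xi < a, ∀ eta < a,
      (eta ∈ L a xi ↔ eta ∈ L b xi) := fun a ha b hb hab xi hxi eta heta =>
    hom a ha b hb hab (.inl (.inl (xi, eta))) (max_lt hxi heta)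
  have homC : ∀ a ∈ H, ∀ b ∈ H, a < b → ∀ xi < a, (xi ∈ C a ↔ xi ∈ C b) :=
    fun a ha b hb hab xi hxi => hom a ha b hb hab (.inl (.inr xi)) hxi
  have homA : ∀ a ∈ H, ∀ b ∈ H, a < b → ∀ x ∈ Vrank a, (x ∈ A a ↔ x ∈ A b) :=
    fun a ha b hb hab x hx => hom a ha b hb hab (.inr (.inl x)) hx
  have homphi : ∀ a ∈ H, ∀ b ∈ H, a < b → 0 < a → phi a = phi b :=
    fun a ha b hb hab h0 => (hom a ha b hb hab (.inr (.inr ⟨phi a⟩)) h0).1 rfl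
  set H' := {a | a ∈ H ∧ (∀ xi < a, L a xi ⊆ Set.Iio xi) ∧ IsClubIn (C a) a ∧
    ∀ xi ∈ C a, ∀ eta ∈ C a, xi < eta → L a xi ≠ L a eta ∩ Set.Iio xi}
  have hU : Unbdd H' kappa := by
    intro g hg
    obtain ⟨a, ha, hga⟩ := hH g hg
    rcases hdata a (hHX ha).1 with h1 | ⟨hA, hsat, -⟩
    · exact ⟨a, ⟨ha, h1⟩, hga⟩
    obtain ⟨b, hb, hab⟩ := hH a (hHk a ha)
    rcases hdata b (hHX hb).1 with h1 | ⟨-, -, hno⟩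
    · exact ⟨b, ⟨hb, h1⟩, hga.trans hab⟩
    refine absurd ?_ (hno a hab)
    have hAeq : A b ∩ Vrank a = A a := by
      ext x
      refine ⟨fun hx => (homA a ha b hb hab x hx.2).2 hx.1, fun hx => ⟨?_, hA hx⟩⟩
      exact (homA a ha b hb hab x (hA hx)).1 hx
    rwa [hAeq, ← homphi a ha b hb hab (pos_of_gt hga)]
  set D := {xi | ∃ a ∈ H', xi ∈ C a}
  have hDC : ∀ a ∈ H', ∀ xi < a, xi ∈ D → xi ∈ C a := by
    rintro a ha xi hxi ⟨b, hb, hxb⟩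
    rcases lt_trichotomy a b with hab | rfl | hab
    · exact (homC a ha.1 b hb.1 hab xi hxi).2 hxb
    · exact hxb
    · exact (homC b hb.1 a ha.1 hab xi (hb.2.2.1.1 hxb)).1 hxb
  have hD : IsClubIn D kappa := by
    refine ⟨?_, fun g hg => ?_, fun b hb hb0 hlim => ?_⟩
    · rintro xi ⟨a, ha, hxa⟩
      exact lt_trans (ha.2.2.1.1 hxa) (hHk a ha.1)
    · obtain ⟨a, ha, hga⟩ := hU g hg
      obtain ⟨xi, hxi, hgx⟩ := ha.2.2.1.2.1 g hga
      exact ⟨xi, ⟨a, ha, hxi⟩, hgx⟩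
    · obtain ⟨a, ha, hba⟩ := hU b hb
      refine ⟨a, ha, ha.2.2.1.2.2 b hba hb0 fun g hg => ?_⟩
      obtain ⟨d, hd, hgd, hdb⟩ := hlim g hg
      exact ⟨d, hDC a ha d (hdb.trans hba) hd, hgd, hdb⟩
  let T : Ordinal.{0} → Set Ordinal.{0} := fun xi => {eta | ∃ a ∈ H', xi < a ∧ eta ∈ L a xi}
  have hT : ∀ a ∈ H', ∀ xi < a, T xi = L a xi := by
    intro a ha xi hxi
    ext eta
    refine ⟨?_, fun he => ⟨a, ha, hxi, he⟩⟩
    rintro ⟨b, hb, hxb, he⟩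
    have hex : eta < xi := hb.2.1 xi hxb he
    rcases lt_trichotomy a b with hab | rfl | hab
    · exact (homL a ha.1 b hb.1 hab xi hxi eta (hex.trans hxi)).2 he
    · exact he
    · exact (homL b hb.1 a ha.1 hab xi hxb eta (hex.trans hxb)).1 he
  obtain ⟨K, hKX, hK, homT⟩ := exists_unbdd_homog h hX hD (smallRank_id h) T
  obtain ⟨xi, hxi, -⟩ := hK 0 (pos_of_gt h.1)
  obtain ⟨eta, heta, hlt⟩ := hK xi (hD.1 (hKX hxi).2)
  obtain ⟨a, ha, hea⟩ := hU eta (hD.1 (hKX heta).2)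
  have hxa := hlt.trans hea
  refine ha.2.2.2 xi (hDC a ha xi hxa (hKX hxi).2) eta (hDC a ha eta hea (hKX heta).2) hlt ?_
  rw [← hT a ha xi hxa, ← hT a ha eta hea]
  ext z
  refine ⟨fun hz => ?_, fun hz => (homT xi hxi eta heta hlt z hz.2).2 hz.1⟩
  have hzx : z < xi := by
    rw [hT a ha xi hxa] at hz
    exact ha.2.1 xi hxa hz
  exact ⟨(homT xi hxi eta heta hlt z hzx).1 hz, hzx⟩

end Lists

theorem isPiForm_and_isSigmaForm_of_FO {phi : SOForm} (h : phi.FO) (m : ℕ) :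
    IsPiForm m phi ∧ IsSigmaForm m phi := by
  induction m with
  | zero => exact ⟨.fo h, .fo h⟩
  | succ m ih => exact ⟨.up ih.2, .up ih.1⟩

theorem PiIndesc.unbdd {m : ℕ} {H : Set Ordinal.{0}} {kappa : Ordinal.{0}}
    (hH : PiIndesc m H kappa) : Unbdd H kappa := by
  intro gamma hg
  obtain ⟨xi, hxi, hsat⟩ := hH.2 {ZFSet.vonNeumann gamma}
    (by simpa [Vrank, ZFSet.rank_vonNeumann] using hg)
    (.not (.fall (.not (.inA 0)))) (isPiForm_and_isSigmaForm_of_FO (by simp [SOForm.FO]) m).1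
    (by simpa [SOSatS, SOSat, consVal, Vrank, ZFSet.rank_vonNeumann] using hg)
  refine ⟨xi, hxi, ?_⟩
  simp only [SOSatS, SOSat, consVal, not_forall, not_not] at hsat
  obtain ⟨x, hx, rfl, -⟩ := hsat
  simpa [Vrank, ZFSet.rank_vonNeumann] using hx

theorem PiPos.unbdd {n : ℤ} {H : Set Ordinal.{0}} {kappa : Ordinal.{0}}
    (h : RegUncountable kappa) (hH : PiPos n H kappa) : Unbdd H kappa := by
  cases n with
  | ofNat m => exact PiIndesc.unbdd hH
  | negSucc m =>
    intro gamma hg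
    by_contra! hle
    have hsub : H ⊆ Set.Iio (gamma + 1) := fun a ha => Order.lt_add_one_iff.2 (hle a ha)
    have hcard := Cardinal.mk_le_mk_of_subset hsub
    rw [hH.2, Cardinal.mk_Iio_ordinal, Cardinal.lift_le] at hcard
    exact (h.card_lt (h.isSuccLimit.add_one_lt hg)).not_ge hcard

theorem IneffPos.mono {kappa : Ordinal.{0}} {P Q : Set Ordinal.{0} → Prop} {S : Set Ordinal.{0}}
    (hPQ : ∀ H, P H → Q H) (hS : IneffPos kappa P S) : IneffPos kappa Q S :=
  ⟨hS.1, fun L hL => by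
    obtain ⟨H, hHS, hP, hom⟩ := hS.2 L hL
    exact ⟨H, hHS, hPQ H hP, hom⟩⟩

theorem compl_subtle_indesc_mem_ineffIdeal {n : ℤ} (hn : -1 ≤ n) {kappa : Ordinal.{0}}
    (hreg : RegUncountable kappa) :
    Set.Iio kappa \ {alpha | alpha < kappa ∧ IsSubtleIn (Set.Iio alpha) alpha ∧
      PiPos (n + 2) (Set.Iio alpha) alpha} ∈ IneffIdeal n kappa := by
  refine ⟨Set.sdiff_subset, fun hpos => ?_⟩
  obtain ⟨m, hm⟩ := Int.eq_ofNat_of_zero_le (show 0 ≤ n + 2 by omega)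
  obtain ⟨alpha, ⟨hak, hano⟩, hsub, hind⟩ :=
    exists_subtle_indesc hreg (hpos.mono fun _ hH => PiPos.unbdd hreg hH) m
  exact hano ⟨hak, hsub, by rw [hm]; exact hind⟩

/-- For `n ∈ {-1} ∪ ω`, if `κ ∉ 𝓘(Π¹ₙ(κ))` then the set of `α < κ` which
are subtle and `Π¹_{n+2}`-indescribable cardinals belongs to the dual filter `𝓘(Π¹ₙ(κ))*`
(i.e. its complement in `κ` is in the ideal); in particular the least cardinal which is
both subtle and `Π¹_{n+2}`-indescribable is in `𝓘(Π¹ₙ)` about itself. -/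
theorem subtle_indesc_in_dual_filter (n : ℤ) (hn : -1 ≤ n)
    (kappa : Ordinal.{0}) (hreg : RegUncountable kappa)
    (h : IneffPos kappa (fun H => PiPos n H kappa) (Set.Iio kappa)) :
    (Set.Iio kappa \
        {alpha | alpha < kappa ∧ IsSubtleIn (Set.Iio alpha) alpha ∧
          PiPos (n + 2) (Set.Iio alpha) alpha} ∈ IneffIdeal n kappa) ∧
    (∀ kappa0 : Ordinal.{0}, RegUncountable kappa0 →
      IsSubtleIn (Set.Iio kappa0) kappa0 → PiPos (n + 2) (Set.Iio kappa0) kappa0 →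
      (∀ alpha < kappa0,
        ¬ (IsSubtleIn (Set.Iio alpha) alpha ∧ PiPos (n + 2) (Set.Iio alpha) alpha)) →
      ¬ IneffPos kappa0 (fun H => PiPos n H kappa0) (Set.Iio kappa0)) := by
  refine ⟨compl_subtle_indesc_mem_ineffIdeal hn hreg, fun kappa0 hreg0 _ _ hleast hpos => ?_⟩
  have hmem := compl_subtle_indesc_mem_ineffIdeal hn hreg0
  rw [sdiff_eq_left.2] at hmem
  · exact hmem.2 hpos
  · exact Set.disjoint_left.2 fun alpha ha hs => hleast alpha ha hs.2

end LCI
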